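/- arXiv:2102.06967 — 12 statements merged into one kernel-verified Lean document; each statement's English description precedes it below -/
import Mathlib

section
/- Let (X, κ₁, κ₂) be a bispace and let i, j ∈ {1,2} with i ≠ j. If a set B ⊆ X is (j−i)sg*κ-closed, then there exists an sκᵢ-closed set F with B ⊆ F such that F − B contains no nonempty sκⱼ-closed set. -/
open Set

/-- A σ-space (Alexandroff space): ∅ and X are open, countable unions and
finite (binary) intersections of open sets are open. -/
structure SigmaSpace (X : Type*) where
  opens : Set (Set X)
  empty_mem : ∅ ∈ opens
  univ_mem : Set.univ ∈ opens
  sUnion_mem : ∀ S : Set (Set X), S.Countable → S ⊆ opens → ⋃₀ S ∈ opens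
  inter_mem : ∀ A B : Set X, A ∈ opens → B ∈ opens → A ∩ B ∈ opens

variable {X : Type*}

/-- A set is κ-open if it belongs to the family of opens. -/
def SigmaSpace.IsOpen (κ : SigmaSpace X) (A : Set X) : Prop := A ∈ κ.opens

/-- A set is κ-closed if its complement is κ-open. -/
def SigmaSpace.IsClosed (κ : SigmaSpace X) (A : Set X) : Prop := Aᶜ ∈ κ.opens

/-- The κ-closure of `A`: points all of whose κ-open neighbourhoods meet `A`. -/
def SigmaSpace.cl (κ : SigmaSpace X) (A : Set X) : Set X :=
  {x | ∀ U ∈ κ.opens, x ∈ U → (U ∩ A).Nonempty}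

/-- `B` is semi κ-open if there is a κ-open `G` with `G ⊆ B ⊆ cl G`. -/
def SigmaSpace.SemiOpen (κ : SigmaSpace X) (B : Set X) : Prop :=
  ∃ G ∈ κ.opens, G ⊆ B ∧ B ⊆ κ.cl G

/-- `B` is semi κ-closed if its complement is semi κ-open. -/
def SigmaSpace.SemiClosed (κ : SigmaSpace X) (B : Set X) : Prop :=
  κ.SemiOpen Bᶜ

/-- The semi κ-closure of `A`: points all of whose semi κ-open neighbourhoods meet `A`. -/
def SigmaSpace.scl (κ : SigmaSpace X) (A : Set X) : Set X :=
  {x | ∀ U, κ.SemiOpen U → x ∈ U → (U ∩ A).Nonempty}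

/-- `B` is (j−i)sg*κ-closed in the bispace `κ` (where `i j : Fin 2` index the two
σ-structures): there is an sκᵢ-closed set `F ⊇ B` such that `F ⊆ O` whenever
`O` is sκⱼ-open and `B ⊆ O`. -/
def SgClosed (κ : Fin 2 → SigmaSpace X) (i j : Fin 2) (B : Set X) : Prop :=
  ∃ F, (κ i).SemiClosed F ∧ B ⊆ F ∧ ∀ O, (κ j).SemiOpen O → B ⊆ O → F ⊆ O

/-- `B` is (j−i)sg*κ-open if its complement is (j−i)sg*κ-closed. -/
def SgOpen (κ : Fin 2 → SigmaSpace X) (i j : Fin 2) (B : Set X) : Prop :=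
  SgClosed κ i j Bᶜ

/-- The semi-kernel of `B` w.r.t. `κ j`: the intersection of all sκⱼ-open sets containing `B`. -/
def sker (κ : Fin 2 → SigmaSpace X) (j : Fin 2) (B : Set X) : Set X :=
  ⋂₀ {U | (κ j).SemiOpen U ∧ B ⊆ U}

/-- Pairwise semi-T₀. -/
def PairwiseSemiT0 (κ : Fin 2 → SigmaSpace X) : Prop :=
  ∀ x y : X, x ≠ y →
    (∃ U, (κ 0).SemiOpen U ∧ x ∈ U ∧ y ∉ U) ∨
    (∃ V, (κ 1).SemiOpen V ∧ y ∈ V ∧ x ∉ V)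

/-- Pairwise semi-T₁. -/
def PairwiseSemiT1 (κ : Fin 2 → SigmaSpace X) : Prop :=
  ∀ x y : X, x ≠ y →
    (∃ U, (κ 0).SemiOpen U ∧ x ∈ U ∧ y ∉ U) ∧
    (∃ V, (κ 1).SemiOpen V ∧ y ∈ V ∧ x ∉ V)

/-- Pairwise semi-R₀. -/
def PairwiseSemiR0 (κ : Fin 2 → SigmaSpace X) : Prop :=
  ∀ i j : Fin 2, i ≠ j → ∀ U, (κ i).SemiOpen U → ∀ x ∈ U, (κ j).scl {x} ⊆ U

/-- Pairwise semi-symmetric. -/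
def PairwiseSemiSymmetric (κ : Fin 2 → SigmaSpace X) : Prop :=
  ∀ x y : X, ∀ i j : Fin 2, i ≠ j → x ∈ (κ i).scl {y} → y ∈ (κ j).scl {x}

/-- Pairwise strongly semi-symmetric: every singleton is (j−i)sg*κ-closed. -/
def PairwiseStronglySemiSymmetric (κ : Fin 2 → SigmaSpace X) : Prop :=
  ∀ x : X, ∀ i j : Fin 2, i ≠ j → SgClosed κ i j {x}

/-- Pairwise semi-T_ω: every (j−i)sg*κ-closed set is sκᵢ-closed. -/
def PairwiseSemiTOmega (κ : Fin 2 → SigmaSpace X) : Prop :=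
  ∀ i j : Fin 2, i ≠ j → ∀ B : Set X, SgClosed κ i j B → (κ i).SemiClosed B

/-- The (j−i)sg*κ-closure of `D`. -/
def sgCl (κ : Fin 2 → SigmaSpace X) (i j : Fin 2) (D : Set X) : Set X :=
  ⋂₀ {A | D ⊆ A ∧ SgClosed κ i j A}

theorem stmt2 {X : Type*} (κ : Fin 2 → SigmaSpace X) (i j : Fin 2) (hij : i ≠ j) (B : Set X)
    (hB : SgClosed κ i j B) :
    ∃ F, (κ i).SemiClosed F ∧ B ⊆ F ∧
      ∀ P : Set X, (κ j).SemiClosed P → P ⊆ F \ B → P = ∅ := by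
  obtain ⟨F, hF, hBF, hFO⟩ := hB
  refine ⟨F, hF, hBF, fun P hP hPF => eq_empty_of_forall_notMem fun x hx => ?_⟩
  exact hFO Pᶜ hP (fun y hyB hyP => (hPF hyP).2 hyB) (hPF hx).1 hx
end

section
/- Let (X, κ₁, κ₂) be a bispace, let i, j ∈ {1,2} with i ≠ j, and suppose D ⊆ X is (i−j)sg*κ-closed. Then D is sκⱼ-closed if and only if s-cl_j(D) is sκⱼ-closed and s-cl_j(D) − D is sκᵢ-closed. -/
open Set

variable {X : Type*}

theorem SigmaSpace.subset_scl {X : Type*} (κ : SigmaSpace X) (A : Set X) : A ⊆ κ.scl A :=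
  fun x hx _ _ hxU => ⟨x, hxU, hx⟩

theorem SigmaSpace.SemiClosed.scl_subset {X : Type*} {κ : SigmaSpace X} {A F : Set X}
    (hF : κ.SemiClosed F) (hAF : A ⊆ F) : κ.scl A ⊆ F := by
  intro x hx
  by_contra hxF
  obtain ⟨y, hyF, hyA⟩ := hx Fᶜ hF hxF
  exact hyF (hAF hyA)

theorem SigmaSpace.SemiClosed.scl_eq {X : Type*} {κ : SigmaSpace X} {A : Set X}
    (hA : κ.SemiClosed A) : κ.scl A = A :=
  (hA.scl_subset Subset.rfl).antisymm (κ.subset_scl A)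

theorem SigmaSpace.semiClosed_empty {X : Type*} (κ : SigmaSpace X) : κ.SemiClosed ∅ :=
  ⟨univ, κ.univ_mem, by simp, fun x _ _ _ hxU => ⟨x, hxU, mem_univ x⟩⟩

theorem stmt3 {X : Type*} (κ : Fin 2 → SigmaSpace X) (i j : Fin 2) (hij : i ≠ j) (D : Set X)
    (hD : SgClosed κ j i D) :
    (κ j).SemiClosed D ↔
      (κ j).SemiClosed ((κ j).scl D) ∧ (κ i).SemiClosed ((κ j).scl D \ D) := by
  constructor
  · intro h
    rw [h.scl_eq, sdiff_self]
    exact ⟨h, (κ i).semiClosed_empty⟩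
  · rintro ⟨hcl, hdiff⟩
    obtain ⟨F, hF, hDF, hFO⟩ := hD
    have hF_sub : F ⊆ ((κ j).scl D \ D)ᶜ := hFO _ hdiff fun x hx hx' => hx'.2 hx
    have h_sub : (κ j).scl D ⊆ D := fun x hx =>
      by_contra fun hxD => hF_sub (hF.scl_subset hDF hx) ⟨hx, hxD⟩
    rwa [h_sub.antisymm ((κ j).subset_scl D)] at hcl
end

section
/- Let (X, κ₁, κ₂) be a bispace and let i, j ∈ {1,2} with i ≠ j. If the union of any two sκᵢ-closed sets is (j−i)sg*κ-closed, then the union of any two (j−i)sg*κ-closed sets is (j−i)sg*κ-closed. -/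
open Set

variable {X : Type*}

theorem stmt4 {X : Type*} (κ : Fin 2 → SigmaSpace X) (i j : Fin 2) (hij : i ≠ j)
    (h : ∀ A B : Set X, (κ i).SemiClosed A → (κ i).SemiClosed B → SgClosed κ i j (A ∪ B)) :
    ∀ E F : Set X, SgClosed κ i j E → SgClosed κ i j F → SgClosed κ i j (E ∪ F) := by
  rintro E F ⟨E', hE', hEE', hE⟩ ⟨F', hF', hFF', hF⟩
  obtain ⟨K, hK, hsub, hmin⟩ := h E' F' hE' hF'
  refine ⟨K, hK, (union_subset_union hEE' hFF').trans hsub, fun O hO hEFO => hmin O hO ?_⟩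
  exact union_subset (hE O hO (subset_union_left.trans hEFO))
    (hF O hO (subset_union_right.trans hEFO))
end

section
/- Let (X, κ₁, κ₂) be a bispace and let i, j ∈ {1,2} with i ≠ j. If E₁ and E₂ are semi κⱼ-separated sets that are both (j−i)sg*κ-open, then E₁ ∪ E₂ is (j−i)sg*κ-open. -/
open Set

variable {X : Type*}

theorem SigmaSpace.cl_mono {X : Type*} (κ : SigmaSpace X) {A B : Set X} (h : A ⊆ B) :
    κ.cl A ⊆ κ.cl B :=
  fun _ hx U hU hxU => (hx U hU hxU).mono (inter_subset_inter_right U h)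

theorem SigmaSpace.union_mem {X : Type*} (κ : SigmaSpace X) {A B : Set X}
    (hA : A ∈ κ.opens) (hB : B ∈ κ.opens) : A ∪ B ∈ κ.opens := by
  rw [← sUnion_pair]
  exact κ.sUnion_mem _ (Set.toFinite _).countable (pair_subset hA hB)

theorem SigmaSpace.SemiOpen.union {X : Type*} {κ : SigmaSpace X} {A B : Set X}
    (hA : κ.SemiOpen A) (hB : κ.SemiOpen B) : κ.SemiOpen (A ∪ B) := by
  obtain ⟨G, hG, hGA, hAG⟩ := hA
  obtain ⟨H, hH, hHB, hBH⟩ := hB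
  exact ⟨G ∪ H, κ.union_mem hG hH, union_subset_union hGA hHB,
    union_subset (hAG.trans (κ.cl_mono subset_union_left))
      (hBH.trans (κ.cl_mono subset_union_right))⟩

theorem SigmaSpace.SemiClosed.inter {X : Type*} {κ : SigmaSpace X} {A B : Set X}
    (hA : κ.SemiClosed A) (hB : κ.SemiClosed B) : κ.SemiClosed (A ∩ B) := by
  unfold SigmaSpace.SemiClosed at *
  rw [compl_inter]
  exact hA.union hB

theorem stmt5 {X : Type*} (κ : Fin 2 → SigmaSpace X) (i j : Fin 2) (hij : i ≠ j)
    (E₁ E₂ : Set X)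
    (hsep : ∃ G H : Set X, (κ j).SemiOpen G ∧ (κ j).SemiOpen H ∧
      E₁ ⊆ G ∧ E₂ ⊆ H ∧ E₁ ∩ H = ∅ ∧ E₂ ∩ G = ∅)
    (h₁ : SgOpen κ i j E₁) (h₂ : SgOpen κ i j E₂) :
    SgOpen κ i j (E₁ ∪ E₂) := by
  obtain ⟨G, H, hG, hH, hE₁G, hE₂H, hE₁H, hE₂G⟩ := hsep
  obtain ⟨F₁, hF₁, hEF₁, hO₁⟩ := h₁
  obtain ⟨F₂, hF₂, hEF₂, hO₂⟩ := h₂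
  refine ⟨F₁ ∩ F₂, hF₁.inter hF₂, ?_, fun O hO hEO => ?_⟩
  · rw [compl_union]
    exact inter_subset_inter hEF₁ hEF₂
  · have hcover : ∀ x, x ∉ O → x ∈ E₁ ∨ x ∈ E₂ := fun x hx => by
      by_contra hE
      exact hx (hEO hE)
    have hF₁O : F₁ ⊆ O ∪ H := hO₁ _ (hO.union hH) fun x hx =>
      or_iff_not_imp_left.2 fun hxO => hE₂H ((hcover x hxO).resolve_left hx)
    have hF₂O : F₂ ⊆ O ∪ G := hO₂ _ (hO.union hG) fun x hx =>
      or_iff_not_imp_left.2 fun hxO => hE₁G ((hcover x hxO).resolve_right hx)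
    rintro x ⟨hx₁, hx₂⟩
    by_contra hxO
    rcases hcover x hxO with hx | hx
    · exact (hE₁H.subset ⟨hx, (hF₁O hx₁).resolve_left hxO⟩).elim
    · exact (hE₂G.subset ⟨hx, (hF₂O hx₂).resolve_left hxO⟩).elim
end

section
/- Let (X, κ₁, κ₂) be a bispace and let i, j ∈ {1,2} with i ≠ j. If C ⊆ X is (j−i)sg*κ-closed and C ⊆ D ⊆ s-cl_i(C), then D is (j−i)sg*κ-closed. -/
open Set

variable {X : Type*}

theorem stmt6 {X : Type*} (κ : Fin 2 → SigmaSpace X) (i j : Fin 2) (hij : i ≠ j)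
    (C D : Set X) (hC : SgClosed κ i j C) (hCD : C ⊆ D) (hDcl : D ⊆ (κ i).scl C) :
    SgClosed κ i j D := by
  obtain ⟨F, hF, hCF, hO⟩ := hC
  refine ⟨F, hF, fun x hx => ?_, fun O hOo hDO => hO O hOo (hCD.trans hDO)⟩
  by_contra hxF
  obtain ⟨y, hyF, hyC⟩ := hDcl hx Fᶜ hF hxF
  exact hyF (hCF hyC)
end

section
/- Let (X, κ₁, κ₂) be a bispace. If every subset of X is (j−i)sg*κ-closed for all i, j ∈ {1,2} with i ≠ j, then for each i, j ∈ {1,2} with i ≠ j the family of sκᵢ-closed subsets of X coincides with the family of sκⱼ-open subsets of X. -/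
open Set

variable {X : Type*}

/-- If `B` is both (j−i)sg*κ-closed and sκⱼ-open, then it is sκᵢ-closed. -/
theorem SgClosed.semiClosed_of_semiOpen {X : Type*} {κ : Fin 2 → SigmaSpace X} {i j : Fin 2}
    {B : Set X} (hB : SgClosed κ i j B) (hO : (κ j).SemiOpen B) : (κ i).SemiClosed B := by
  obtain ⟨F, hF, hBF, hmin⟩ := hB
  rwa [hBF.antisymm (hmin B hO subset_rfl)]

theorem stmt8 {X : Type*} (κ : Fin 2 → SigmaSpace X)
    (h : ∀ i j : Fin 2, i ≠ j → ∀ B : Set X, SgClosed κ i j B) :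
    ∀ i j : Fin 2, i ≠ j → ∀ A : Set X, (κ i).SemiClosed A ↔ (κ j).SemiOpen A := by
  intro i j hij A
  refine ⟨fun hA => ?_, (h i j hij A).semiClosed_of_semiOpen⟩
  have hAc : (κ j).SemiOpen Aᶜᶜ := (h j i hij.symm Aᶜ).semiClosed_of_semiOpen hA
  rwa [compl_compl] at hAc
end

section
/- Let (X, κ₁, κ₂) be a bispace and let i, j ∈ {1,2} with i ≠ j. For each x ∈ X, if the singleton {x} is not sκᵢ-closed, then its complement X − {x} is (i−j)sg*κ-closed. -/
open Set

variable {X : Type*}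

theorem stmt10 {X : Type*} (κ : Fin 2 → SigmaSpace X) (i j : Fin 2) (hij : i ≠ j)
    (x : X) (hx : ¬ (κ i).SemiClosed {x}) :
    SgClosed κ j i ({x}ᶜ) := by
  refine ⟨univ, ⟨∅, (κ j).empty_mem, empty_subset _, by simp⟩, subset_univ _, ?_⟩
  intro O hO hsub y _
  by_contra hy
  have hxO : x ∉ O := fun hxO => hy <| by
    by_cases h : y = x
    · exact h ▸ hxO
    · exact hsub h
  have hOeq : O = {x}ᶜ :=
    Subset.antisymm (fun z hz hzx => hxO (mem_singleton_iff.mp hzx ▸ hz)) hsub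
  subst hOeq
  exact hx hO
end

section
/- If a bispace (X, κ₁, κ₂) is pairwise semi-T₀, then for all p, q ∈ X with p ≠ q one has s-cl_2({p}) ≠ s-cl_1({q}). -/
open Set

variable {X : Type*}

theorem SigmaSpace.mem_scl_singleton_self {X : Type*} (κ : SigmaSpace X) (x : X) :
    x ∈ κ.scl {x} :=
  fun _ _ hx => ⟨x, hx, rfl⟩

theorem SigmaSpace.SemiOpen.mem_of_mem_scl_singleton {X : Type*} {κ : SigmaSpace X} {U : Set X}
    {x y : X} (hU : κ.SemiOpen U) (hx : x ∈ U) (hxy : x ∈ κ.scl {y}) : y ∈ U :=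
  Set.inter_singleton_nonempty.mp (hxy U hU hx)

theorem stmt13 {X : Type*} (κ : Fin 2 → SigmaSpace X) (h : PairwiseSemiT0 κ) :
    ∀ p q : X, p ≠ q → (κ 1).scl {p} ≠ (κ 0).scl {q} := by
  intro p q hpq heq
  rcases h p q hpq with ⟨U, hU, hpU, hqU⟩ | ⟨V, hV, hqV, hpV⟩
  · exact hqU (hU.mem_of_mem_scl_singleton hpU (heq ▸ (κ 1).mem_scl_singleton_self p))
  · exact hpV (hV.mem_of_mem_scl_singleton hqV (heq ▸ (κ 0).mem_scl_singleton_self q))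
end

section
/- If a bispace (X, κ₁, κ₂) is both pairwise semi-T₀ and pairwise semi-R₀, then it is pairwise semi-T₁. -/
open Set

variable {X : Type*}

/-- In a pairwise semi-R₀ bispace, separating `x` from `y` by an sκᵢ-open set yields an
sκⱼ-open set separating `y` from `x`. -/
theorem PairwiseSemiR0.exists_semiOpen_symm {X : Type*} {κ : Fin 2 → SigmaSpace X}
    (hR0 : PairwiseSemiR0 κ) {i j : Fin 2} (hij : i ≠ j) {x y : X}
    (h : ∃ U, (κ i).SemiOpen U ∧ x ∈ U ∧ y ∉ U) :
    ∃ V, (κ j).SemiOpen V ∧ y ∈ V ∧ x ∉ V := by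
  obtain ⟨U, hU, hx, hy⟩ := h
  by_contra hV
  refine hy (hR0 i j hij U hU x hx fun V hVo hyV => ⟨x, ?_, rfl⟩)
  by_contra hxV
  exact hV ⟨V, hVo, hyV, hxV⟩

theorem stmt14 {X : Type*} (κ : Fin 2 → SigmaSpace X)
    (h0 : PairwiseSemiT0 κ) (hR0 : PairwiseSemiR0 κ) :
    PairwiseSemiT1 κ := by
  intro x y hxy
  rcases h0 x y hxy with h | h
  · exact ⟨h, hR0.exists_semiOpen_symm (by decide) h⟩
  · exact ⟨hR0.exists_semiOpen_symm (by decide) h, h⟩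
end

section
/- If a bispace (X, κ₁, κ₂) is both pairwise semi-symmetric and pairwise semi-T₀, then it is pairwise semi-T₁. -/
open Set

variable {X : Type*}

theorem SigmaSpace.notMem_scl_singleton {X : Type*} (κ : SigmaSpace X) (x y : X) :
    x ∉ κ.scl {y} ↔ ∃ U, κ.SemiOpen U ∧ x ∈ U ∧ y ∉ U := by
  simp [SigmaSpace.scl]

theorem stmt15 {X : Type*} (κ : Fin 2 → SigmaSpace X)
    (hsym : PairwiseSemiSymmetric κ) (h0 : PairwiseSemiT0 κ) :
    PairwiseSemiT1 κ := by
  intro x y hxy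
  simp only [← SigmaSpace.notMem_scl_singleton]
  have h := h0 x y hxy
  simp only [← SigmaSpace.notMem_scl_singleton] at h
  rcases h with hx | hy
  · exact ⟨hx, fun hy => hx (hsym y x 1 0 (by decide) hy)⟩
  · exact ⟨fun hx => hy (hsym x y 0 1 (by decide) hx), hy⟩
end

section
/- Every pairwise semi-T_ω bispace (X, κ₁, κ₂) is pairwise semi-T₀. -/
open Set

variable {X : Type*}

theorem stmt17 {X : Type*} (κ : Fin 2 → SigmaSpace X) (h : PairwiseSemiTOmega κ) :
    PairwiseSemiT0 κ := by
  intro x y hxy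
  by_contra! hc
  obtain ⟨hU, hV⟩ := hc
  have hsg : SgClosed κ 0 1 {x}ᶜ := by
    refine ⟨univ, ⟨∅, (κ 0).empty_mem, by simp, by simp⟩, subset_univ _, fun O hO hxO z _ => ?_⟩
    by_cases hz : z = x
    · exact hz ▸ hV O hO (hxO hxy.symm)
    · exact hxO hz
  have hx : (κ 0).SemiOpen {x} := by
    simpa only [SigmaSpace.SemiClosed, compl_compl] using h 0 1 zero_ne_one _ hsg
  exact hxy (hU {x} hx rfl).symm
end

section
/- Every pairwise strongly semi-symmetric bispace (X, κ₁, κ₂) is pairwise semi-symmetric. -/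
open Set

variable {X : Type*}

theorem stmt18 {X : Type*} (κ : Fin 2 → SigmaSpace X)
    (h : PairwiseStronglySemiSymmetric κ) :
    PairwiseSemiSymmetric κ := by
  intro x y i j hij hx U hU hyU
  obtain ⟨F, hF, hyF, hFO⟩ := h y i j hij
  have hxF : x ∈ F := by
    by_contra hxF
    obtain ⟨z, hz, rfl⟩ := hx Fᶜ hF hxF
    exact hz (hyF rfl)
  exact ⟨x, hFO U hU (singleton_subset_iff.mpr hyU) hxF, rfl⟩
end
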